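/- arXiv:1711.10233 — 3 statements merged into one kernel-verified Lean document; each statement's English description precedes it below -/
import Mathlib

section
/- Let K be a category whose hom-sets are complete lattices with composition monotone in both arguments and left distributive over non-empty suprema, and let q : M → N be a surjective monoid homomorphism. Let π be a lax functor over M on X, let π' be a lax functor over N on Y, and let f : X → Y be a morphism of K. Then (for all m ∈ M, f ∘ π_m ≤ π'_{q(m)} ∘ f) if and only if (for all n ∈ N, f ∘ Σ_q(π)_n ≤ π'_n ∘ f). (This is the hom-poset isomorphism exhibiting Σ_q as left adjoint to the change-of-base along q.) -/
open CategoryTheory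

universe u v

variable {K : Type u} [Category.{v} K] [∀ X Y : K, CompleteLattice (X ⟶ Y)]
variable {M N : Type*} [Monoid M] [Monoid N]

/-- `listComp F [n₁, …, n_l]` is the composite `F n₁ ∘ ⋯ ∘ F n_l`
(with `F n_l` applied first), i.e. `F n_l ≫ ⋯ ≫ F n₁`. -/
def listComp {X : K} (F : N → (X ⟶ X)) : List N → (X ⟶ X)
  | [] => 𝟙 X
  | n :: L => listComp F L ≫ F n

/-- `PiAux q π i n` is the family `Π_{n,i}` from the construction of the `q`-saturation. -/
def PiAux (q : M →* N) {X : K} (π : M → (X ⟶ X)) : ℕ → N → (X ⟶ X)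
  | 0, n => sSup {g | ∃ m : M, q m = n ∧ g = π m}
  | i + 1, n => sSup {g | ∃ L : List N, L ≠ [] ∧ L.prod = n ∧ g = listComp (PiAux q π i) L}

/-- `sat q π n` is the `q`-saturation `Σ_q(π)_n = ⨆_{i<ω} Π_{n,i}`. -/
def sat (q : M →* N) {X : K} (π : M → (X ⟶ X)) (n : N) : X ⟶ X :=
  ⨆ i : ℕ, PiAux q π i n


/-- If postcomposition with `f` preserves the supremum of `S`, then `sSup S ≫ f ≤ h` may be checked
on the elements of `S`. -/
theorem sSup_comp_le {A B C : K} {f : B ⟶ C} {S : Set (A ⟶ B)} {h : A ⟶ C}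
    (hLD : sSup S ≫ f = ⨆ g ∈ S, g ≫ f) (hS : ∀ g ∈ S, g ≫ f ≤ h) : sSup S ≫ f ≤ h :=
  hLD.trans_le (iSup₂_le hS)

/-- A family laxly intertwined by `f` with a lax functor `π'` has list composites
laxly intertwined with `π'` at the product of the list. -/
theorem listComp_comp_le
    (hcomp : ∀ {A B C : K} {f f' : A ⟶ B} {g g' : B ⟶ C}, f ≤ f' → g ≤ g' → f ≫ g ≤ f' ≫ g')
    {X Y : K} {F : N → (X ⟶ X)} {π' : N → (Y ⟶ Y)}
    (hπ'1 : 𝟙 Y ≤ π' 1) (hπ'mul : ∀ n n' : N, π' n' ≫ π' n ≤ π' (n * n'))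
    {f : X ⟶ Y} (hF : ∀ n, F n ≫ f ≤ f ≫ π' n) (L : List N) :
    listComp F L ≫ f ≤ f ≫ π' L.prod := by
  induction L with
  | nil => simpa [listComp] using hcomp (le_refl f) hπ'1
  | cons n L ih =>
    rw [List.prod_cons]
    calc listComp F (n :: L) ≫ f = listComp F L ≫ F n ≫ f := Category.assoc _ _ _
      _ ≤ listComp F L ≫ f ≫ π' n := hcomp le_rfl (hF n)
      _ = (listComp F L ≫ f) ≫ π' n := (Category.assoc _ _ _).symm
      _ ≤ (f ≫ π' L.prod) ≫ π' n := hcomp ih le_rfl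
      _ = f ≫ π' L.prod ≫ π' n := Category.assoc _ _ _
      _ ≤ f ≫ π' (n * L.prod) := hcomp le_rfl (hπ'mul _ _)

theorem le_sat (q : M →* N) {X : K} (π : M → (X ⟶ X)) (m : M) : π m ≤ sat q π (q m) :=
  le_iSup_of_le 0 (le_sSup (s := {g | ∃ m' : M, q m' = q m ∧ g = π m'}) ⟨m, rfl, rfl⟩)

/-- The hom-poset isomorphism exhibiting `Σ_q` as left adjoint to the change-of-base
along `q`: for a lax functor `π` over `M` on `X`, a lax functor `π'` over `N` on `Y` and
`f : X ⟶ Y`, we have `f ∘ π_m ≤ π'_{q m} ∘ f` for all `m` iff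
`f ∘ Σ_q(π)_n ≤ π'_n ∘ f` for all `n`.  (Here `g ∘ f` in the informal statement is `f ≫ g`.) -/
theorem stmt2
    (hcomp : ∀ {A B C : K} {f f' : A ⟶ B} {g g' : B ⟶ C}, f ≤ f' → g ≤ g' → f ≫ g ≤ f' ≫ g')
    (hLD : ∀ {A B C : K} (f : B ⟶ C) (S : Set (A ⟶ B)), S.Nonempty →
      sSup S ≫ f = ⨆ g ∈ S, g ≫ f)
    (q : M →* N) (hq : Function.Surjective q)
    {X Y : K} (π : M → (X ⟶ X)) (π' : N → (Y ⟶ Y))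
    (hπ1 : 𝟙 X ≤ π 1) (hπmul : ∀ m m' : M, π m' ≫ π m ≤ π (m * m'))
    (hπ'1 : 𝟙 Y ≤ π' 1) (hπ'mul : ∀ n n' : N, π' n' ≫ π' n ≤ π' (n * n'))
    (f : X ⟶ Y) :
    (∀ m : M, π m ≫ f ≤ f ≫ π' (q m)) ↔ (∀ n : N, sat q π n ≫ f ≤ f ≫ π' n) := by
  constructor
  · intro h n
    have hAux : ∀ (i : ℕ) (n : N), PiAux q π i n ≫ f ≤ f ≫ π' n := by
      intro i
      induction i with
      | zero =>
        intro n
        obtain ⟨m₀, hm₀⟩ := hq n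
        refine sSup_comp_le (hLD f _ ⟨π m₀, m₀, hm₀, rfl⟩) ?_
        rintro _ ⟨m, rfl, rfl⟩
        exact h m
      | succ i ih =>
        intro n
        refine sSup_comp_le (hLD f _ ⟨_, [n], by simp, by simp, rfl⟩) ?_
        rintro _ ⟨L, -, rfl, rfl⟩
        exact listComp_comp_le hcomp hπ'1 hπ'mul ih L
    refine sSup_comp_le (hLD f _ (Set.range_nonempty _)) ?_
    rintro _ ⟨i, rfl⟩
    exact hAux i n
  · exact fun h m => (hcomp (le_sat q π m) le_rfl).trans (h (q m))
end

section
/- Let K be a category whose hom-sets are complete lattices with composition monotone in both arguments and left distributive over non-empty suprema, and let q : M → N be a surjective monoid homomorphism. For every lax functor π' over N on an object X of K, the q-saturation of the reindexed family (π'∘q)_m := π'_{q(m)} equals π' componentwise: Σ_q(π'∘q)_n = π'_n for every n ∈ N. (The composite Σ_q ∘ [q,K] is the identity on lax functors over N.) -/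
open CategoryTheory

universe u v

variable {K : Type u} [Category.{v} K] [∀ X Y : K, CompleteLattice (X ⟶ Y)]
variable {M N : Type*} [Monoid M] [Monoid N]

/-- A composite of a list of components of a family bounded by a lax functor is bounded
by the component of the lax functor at the product of the list. -/
theorem listComp_le
    (hcomp : ∀ {A B C : K} {f f' : A ⟶ B} {g g' : B ⟶ C}, f ≤ f' → g ≤ g' → f ≫ g ≤ f' ≫ g')
    {X : K} {F π : N → (X ⟶ X)} (hF : ∀ n, F n ≤ π n)
    (hone : 𝟙 X ≤ π 1) (hmul : ∀ n n' : N, π n' ≫ π n ≤ π (n * n')) (L : List N) :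
    listComp F L ≤ π L.prod := by
  induction L with
  | nil => simpa [listComp] using hone
  | cons n L ih =>
    rw [List.prod_cons]
    exact (hcomp ih (hF n)).trans (hmul n L.prod)

theorem PiAux_comp_le
    (hcomp : ∀ {A B C : K} {f f' : A ⟶ B} {g g' : B ⟶ C}, f ≤ f' → g ≤ g' → f ≫ g ≤ f' ≫ g')
    (q : M →* N) {X : K} {π : N → (X ⟶ X)}
    (hone : 𝟙 X ≤ π 1) (hmul : ∀ n n' : N, π n' ≫ π n ≤ π (n * n')) (i : ℕ) (n : N) :
    PiAux q (fun m => π (q m)) i n ≤ π n := by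
  induction i generalizing n with
  | zero =>
    rw [PiAux]
    refine sSup_le ?_
    rintro _ ⟨m, rfl, rfl⟩
    exact le_rfl
  | succ i ih =>
    rw [PiAux]
    refine sSup_le ?_
    rintro _ ⟨L, -, rfl, rfl⟩
    exact listComp_le hcomp ih hone hmul L

/-- `Σ_q ∘ [q,K]` is the identity: the `q`-saturation of the reindexed family
`(π' ∘ q)_m = π'_{q m}` of a lax functor `π'` over `N` equals `π'` componentwise. -/
theorem stmt4
    (hcomp : ∀ {A B C : K} {f f' : A ⟶ B} {g g' : B ⟶ C}, f ≤ f' → g ≤ g' → f ≫ g ≤ f' ≫ g')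
    (hLD : ∀ {A B C : K} (f : B ⟶ C) (S : Set (A ⟶ B)), S.Nonempty →
      sSup S ≫ f = ⨆ g ∈ S, g ≫ f)
    (q : M →* N) (hq : Function.Surjective q)
    {X : K} (π' : N → (X ⟶ X))
    (hπ'1 : 𝟙 X ≤ π' 1) (hπ'mul : ∀ n n' : N, π' n' ≫ π' n ≤ π' (n * n')) :
    ∀ n : N, sat q (fun m => π' (q m)) n = π' n := by
  intro n
  refine le_antisymm (iSup_le fun i => PiAux_comp_le hcomp q hπ'1 hπ'mul i n) ?_
  obtain ⟨m, rfl⟩ := hq n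
  refine le_iSup_of_le 0 ?_
  rw [PiAux]
  exact le_sSup ⟨m, rfl, rfl⟩
end

section
/- Let α be a timed transition system on a set X and let R be an equivalence relation on X with quotient map f : X → X/R. Then R is a time-abstract bisimulation for α if and only if there exists a map β : X/R → 𝒫(Σ_τ × X/R) such that f^♯ ∘ A = β ∘ f^♯ in the Kleisli category of the LTS monad, where A : X → 𝒫(Σ_τ × X) is the time-forgetting step map A(x) = {(σ,y) | ∃ t ∈ 𝕋, (σ,t,y) ∈ α(x)}. -/
/- `Option Act` models `Σ_τ`: `none` is the silent label `τ`, `some a` is an action. -/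

/-- Kleisli composition for the LTS monad: `kcomp g f` is `g ∘ f` (`f` applied first). -/
def kcomp {Act X Y Z : Type*} (g : Y → Set (Option Act × Z)) (f : X → Set (Option Act × Y)) :
    X → Set (Option Act × Z) := fun x =>
  {p | ∃ y : Y, ((p.1, y) ∈ f x ∧ ((none, p.2) : Option Act × Z) ∈ g y) ∨
        (((none, y) : Option Act × Y) ∈ f x ∧ (p.1, p.2) ∈ g y)}

/-- Kleisli lifting `f^♯(x) = {(τ, f x)}` of a function `f`. -/
def fsharp {Act X Y : Type*} (f : X → Y) : X → Set (Option Act × Y) :=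
  fun x => {((none : Option Act), f x)}

/-- `R` is a time-abstract bisimulation for the TTS `α`. -/
def TimeAbstractBisim {Act T X : Type*} [AddCommMonoid T]
    (α : X → Set (Option Act × T × X)) (R : X → X → Prop) : Prop :=
  ∀ x y, R x y → ∀ (σ : Option Act) (t : T) (x' : X),
    (σ, t, x') ∈ α x → ∃ y' t', (σ, t', y') ∈ α y ∧ R x' y'

/-- Composing a step map with the lift of `f` afterwards relabels the targets along `f`. -/
theorem mem_kcomp_fsharp_left {Act X Y : Type*} (f : X → Y) (A : X → Set (Option Act × X))
    (x : X) (σ : Option Act) (z : Y) :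
    (σ, z) ∈ kcomp (fsharp f) A x ↔ ∃ y, (σ, y) ∈ A x ∧ f y = z := by
  simp only [kcomp, fsharp, Set.mem_ofPred_eq, Set.mem_singleton_iff, Prod.mk.injEq, true_and]
  constructor
  · rintro ⟨y, ⟨h, rfl⟩ | ⟨h, rfl, rfl⟩⟩
    · exact ⟨y, h, rfl⟩
    · exact ⟨y, h, rfl⟩
  · rintro ⟨y, h, rfl⟩
    exact ⟨y, Or.inl ⟨h, rfl⟩⟩

/-- Composing a step map with the lift of `f` beforehand is precomposition with `f`. -/
theorem kcomp_fsharp_right {Act X Y Z : Type*} (β : Y → Set (Option Act × Z)) (f : X → Y) :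
    kcomp β (fsharp f) = fun x => β (f x) := by
  funext x
  ext ⟨σ, z⟩
  simp only [kcomp, fsharp, Set.mem_ofPred_eq, Set.mem_singleton_iff, Prod.mk.injEq, true_and]
  constructor
  · rintro ⟨y, ⟨⟨rfl, rfl⟩, h⟩ | ⟨rfl, h⟩⟩
    · exact h
    · exact h
  · exact fun h => ⟨f x, Or.inr ⟨rfl, h⟩⟩

/-- An equivalence relation `R` on `X` is a time-abstract bisimulation for `α` iff there
is a map `β : X/R → 𝒫(Σ_τ × X/R)` with `f^♯ ∘ A = β ∘ f^♯`, where `A` is the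
time-forgetting step map of `α` and `f` the quotient map. -/
theorem stmt10 {Act T X : Type*} [AddCommMonoid T]
    (α : X → Set (Option Act × T × X)) (R : X → X → Prop) (hR : Equivalence R) :
    TimeAbstractBisim α R ↔
      ∃ β : Quotient (⟨R, hR⟩ : Setoid X) → Set (Option Act × Quotient (⟨R, hR⟩ : Setoid X)),
        kcomp (fsharp (Quotient.mk (⟨R, hR⟩ : Setoid X)))
            (fun x => {p : Option Act × X | ∃ t : T, (p.1, t, p.2) ∈ α x})
          = kcomp β (fsharp (Quotient.mk (⟨R, hR⟩ : Setoid X))) := by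
  simp only [kcomp_fsharp_right]
  constructor
  · intro h
    have step_subset : ∀ x y, R x y →
        kcomp (fsharp (Quotient.mk (⟨R, hR⟩ : Setoid X)))
            (fun x => {p : Option Act × X | ∃ t : T, (p.1, t, p.2) ∈ α x}) x ⊆
          kcomp (fsharp (Quotient.mk (⟨R, hR⟩ : Setoid X)))
            (fun x => {p : Option Act × X | ∃ t : T, (p.1, t, p.2) ∈ α x}) y := by
      rintro x y hxy ⟨σ, z⟩ hz
      rw [mem_kcomp_fsharp_left] at hz ⊢
      obtain ⟨x', ⟨t, ht⟩, rfl⟩ := hz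
      obtain ⟨y', t', ht', hxy'⟩ := h x y hxy σ t x' ht
      exact ⟨y', ⟨t', ht'⟩, Quotient.sound (hR.symm hxy')⟩
    exact ⟨Quotient.lift _ fun x y hxy =>
      (step_subset x y hxy).antisymm (step_subset y x (hR.symm hxy)), rfl⟩
  · rintro ⟨β, hβ⟩ x y hxy σ t x' hx'
    have hmem := (mem_kcomp_fsharp_left (Quotient.mk (⟨R, hR⟩ : Setoid X))
      (fun x => {p : Option Act × X | ∃ t : T, (p.1, t, p.2) ∈ α x}) x σ _).2 ⟨x', ⟨t, hx'⟩, rfl⟩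
    have hq : Quotient.mk (⟨R, hR⟩ : Setoid X) x = Quotient.mk _ y := Quotient.sound hxy
    rw [congrFun hβ x, hq, ← congrFun hβ y, mem_kcomp_fsharp_left] at hmem
    obtain ⟨y', ⟨t', ht'⟩, hy'⟩ := hmem
    exact ⟨y', t', ht', hR.symm (Quotient.exact hy')⟩
end
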